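/- For every initialization x₀ = x_{−1} ∈ ℝ^d and every error sequence with Σ_{k≥0} ‖w_k‖² < ∞, the inexact NAG iterates satisfy Σ_{k≥0} (f(x_k) − f_*) ≤ L̄_NAG(α)²·Σ_{k≥0} ‖w_k‖² + H̄(x₀). Moreover, L̄_NAG(α) → 2√5/√μ as α → 0⁺. -/

import Mathlib

/-- `L̄_NAG(α)`, the explicit ℓ2-gain bound for NAG. -/
noncomputable def LNAG (μ L α : ℝ) : ℝ :=
  Real.sqrt
    (4 * (5 - 2 * Real.sqrt (α * μ) + α * μ) / (μ * (1 + Real.sqrt (α * μ)) ^ 2) +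
      Real.sqrt α * (1 + α * L) / Real.sqrt μ +
      8 * α ^ 3 * L ^ 4 * (4 + (1 - Real.sqrt (α * μ)) ^ 2) /
        (μ ^ 2 * (1 + Real.sqrt (α * μ)) ^ 2))

/-- `H̄(x₀)`, the initialization-dependent constant in the NAG ℓ2-gain bound. -/
noncomputable def HbarNAG {d : ℕ} (μ α : ℝ) (f : EuclideanSpace ℝ (Fin d) → ℝ)
    (fstar : ℝ) (xstar x₀ : EuclideanSpace ℝ (Fin d)) : ℝ :=
  2 / Real.sqrt (α * μ) *
    (1 + Real.sqrt (α * μ) * (1 - Real.sqrt (α * μ)) /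
        (4 * (5 - 2 * Real.sqrt (α * μ) + α * μ)) +
      Real.sqrt (α * μ) * (1 - Real.sqrt (α * μ)) ^ 2 /
        (4 * (4 + (1 - Real.sqrt (α * μ)) ^ 2))) *
    (f x₀ - fstar + μ / 2 * ‖x₀ - xstar‖ ^ 2)

section helpers
variable {E : Type*} [NormedAddCommGroup E] [InnerProductSpace ℝ E] [CompleteSpace E]

theorem aux_line (f : E → ℝ) (hdiff : Differentiable ℝ f) (x v : E) (t : ℝ) :
    HasDerivAt (fun t : ℝ => f (x + t • v)) (inner ℝ (gradient f (x + t • v)) v) t := by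
  have h1 : HasDerivAt (fun t : ℝ => x + t • v) v t := by
    simpa using ((hasDerivAt_id t).smul_const v).const_add x
  have h2 := (hdiff (x + t • v)).hasGradientAt.hasFDerivAt
  have h3 := h2.comp_hasDerivAt t h1
  exact h3.congr_deriv (by simp)

theorem aux_descent (f : E → ℝ) (hdiff : Differentiable ℝ f) (L : ℝ)
    (hsmooth : ∀ x y : E, ‖gradient f x - gradient f y‖ ≤ L * ‖x - y‖) (x v : E) :
    f (x + v) ≤ f x + inner ℝ (gradient f x) v + L / 2 * ‖v‖ ^ 2 := by
  have hd : ∀ t : ℝ, HasDerivAt (fun t : ℝ => f (x + t • v) - t * inner ℝ (gradient f x) v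
      - t ^ 2 * (L / 2 * ‖v‖ ^ 2))
      (inner ℝ (gradient f (x + t • v)) v - inner ℝ (gradient f x) v - 2 * t * (L / 2 * ‖v‖ ^ 2)) t := by
    intro t
    have h1 := aux_line f hdiff x v t
    have h2 : HasDerivAt (fun t : ℝ => t * inner ℝ (gradient f x) v) (inner ℝ (gradient f x) v) t := by
      simpa using (hasDerivAt_id t).mul_const (inner ℝ (gradient f x) v)
    have h3 : HasDerivAt (fun t : ℝ => t ^ 2 * (L / 2 * ‖v‖ ^ 2)) (2 * t * (L / 2 * ‖v‖ ^ 2)) t := by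
      simpa using (hasDerivAt_pow 2 t).mul_const (L / 2 * ‖v‖ ^ 2)
    exact (h1.sub h2).sub h3
  have ha := antitoneOn_of_deriv_nonpos (convex_Icc (0 : ℝ) 1)
    (fun t _ => (hd t).continuousAt.continuousWithinAt)
    (fun t _ => (hd t).differentiableAt.differentiableWithinAt)
    (by
      intro t ht
      rw [interior_Icc] at ht
      rw [(hd t).deriv, ← inner_sub_left]
      have h1 := real_inner_le_norm (gradient f (x + t • v) - gradient f x) v
      have h2 := hsmooth (x + t • v) x
      rw [add_sub_cancel_left, norm_smul, Real.norm_of_nonneg ht.1.le] at h2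
      nlinarith [mul_le_mul_of_nonneg_right h2 (norm_nonneg v)])
  have := ha (Set.left_mem_Icc.2 zero_le_one) (Set.right_mem_Icc.2 zero_le_one) zero_le_one
  simp only [zero_smul, add_zero, one_smul, zero_mul, one_mul, sub_zero, one_pow,
    ne_eq, OfNat.ofNat_ne_zero, not_false_eq_true, zero_pow] at this
  linarith

theorem aux_sc (f : E → ℝ) (hdiff : Differentiable ℝ f) (μ : ℝ)
    (hsc : ConvexOn ℝ Set.univ (fun x => f x - μ / 2 * ‖x‖ ^ 2)) (x v : E) :
    f x + inner ℝ (gradient f x) v + μ / 2 * ‖v‖ ^ 2 ≤ f (x + v) := by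
  have hexp : ∀ t : ℝ, ‖x + t • v‖ ^ 2 = ‖x‖ ^ 2 + t * (2 * inner ℝ x v) + t ^ 2 * ‖v‖ ^ 2 := by
    intro t
    rw [norm_add_sq_real, inner_smul_right, norm_smul, mul_pow, Real.norm_eq_abs, sq_abs]; ring
  have hc : ConvexOn ℝ Set.univ (fun t : ℝ => f (x + t • v) - μ / 2 * ‖x + t • v‖ ^ 2) := by
    refine ⟨convex_univ, fun a _ b _ p q hp hq hpq => ?_⟩
    have := hsc.2 (Set.mem_univ (x + a • v)) (Set.mem_univ (x + b • v)) hp hq hpq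
    have e : p • (x + a • v) + q • (x + b • v) = x + (p • a + q • b) • v := by
      have : q = 1 - p := by linarith
      subst this
      simp only [smul_eq_mul]
      module
    rw [e] at this
    exact this
  have hd : HasDerivAt (fun t : ℝ => f (x + t • v) - μ / 2 * ‖x + t • v‖ ^ 2)
      (inner ℝ (gradient f x) v - μ / 2 * (2 * inner ℝ x v)) 0 := by
    have h1 := aux_line f hdiff x v 0
    simp only [hexp]
    have h2 : HasDerivAt (fun t : ℝ => ‖x‖ ^ 2 + t * (2 * inner ℝ x v) + t ^ 2 * ‖v‖ ^ 2)
        (2 * inner ℝ x v) 0 := by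
      have := (((hasDerivAt_id (0:ℝ)).mul_const (2 * inner ℝ x v)).const_add (‖x‖ ^ 2)).add
        ((hasDerivAt_pow 2 (0:ℝ)).mul_const (‖v‖ ^ 2))
      exact this.congr_deriv (by simp)
    have h3 := h1.sub (h2.const_mul (μ / 2))
    exact h3.congr_deriv (by simp)
  have := hc.le_slope_of_hasDerivAt (Set.mem_univ 0) (Set.mem_univ 1) zero_lt_one hd
  have h1 := hexp 1
  simp only [slope_def_field, zero_smul, add_zero, one_smul, sub_zero, div_one, one_mul, one_pow] at this h1
  rw [h1] at this
  linarith

set_option maxHeartbeats 1000000 in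
theorem aux_step (p q g w : E) (s r μ L α F Fp Fy : ℝ) (hs : 0 < s) (hs1 : s < 1) (hr : r * (1 + s) = 1)
    (hr0 : 0 < r)
    (hμ : 0 < μ) (hL : 0 < L) (hα : 0 < α) (hαL : α * L ≤ 1) (hsq : s ^ 2 = α * μ)
    (Y U : E) (hY : Y = r • q + (s * r) • p) (hU : U = r • p + (s * r) • q)
    (h1 : Fp ≤ Fy + inner ℝ g (-(α • (g + w))) + L / 2 * ‖-(α • (g + w))‖ ^ 2)
    (h2 : Fy + inner ℝ g (q - Y) + μ / 2 * ‖q - Y‖ ^ 2 ≤ F)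
    (h3 : Fy + inner ℝ g (-Y) + μ / 2 * ‖-Y‖ ^ 2 ≤ 0)
    (h4 : μ / 2 * ‖q‖ ^ 2 ≤ F)
    (h5 : ‖g‖ ≤ L * ‖Y‖) :
    Fp + μ / 2 * ‖U - (s / μ) • (g + w)‖ ^ 2 + s / 2 * F ≤ F + μ / 2 * ‖p‖ ^ 2
      + (2 * s / μ + α * (1 + α * L) / 2 + 4 * s * α ^ 3 * L ^ 4 / μ ^ 2) * ‖w‖ ^ 2 := by
  have hsr : 0 ≤ s * r := by positivity
  have cvx : ∀ (a b : E) (t : ℝ), 0 ≤ t → t ≤ 1 →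
      ‖(1 - t) • a + t • b‖ ^ 2 ≤ (1 - t) * ‖a‖ ^ 2 + t * ‖b‖ ^ 2 := by
    intro a b t h0 h1
    have e : (1 - t) * ‖a‖ ^ 2 + t * ‖b‖ ^ 2 - ‖(1 - t) • a + t • b‖ ^ 2
        = t * (1 - t) * ‖a - b‖ ^ 2 := by
      rw [norm_add_sq_real, norm_sub_sq_real, inner_smul_left, inner_smul_right, norm_smul,
        norm_smul, mul_pow, mul_pow, Real.norm_eq_abs, Real.norm_eq_abs, sq_abs, sq_abs]
      simp only [conj_trivial]; ring
    have : 0 ≤ t * (1 - t) * ‖a - b‖ ^ 2 :=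
      mul_nonneg (mul_nonneg h0 (by linarith)) (sq_nonneg _)
    linarith
  have hr' : r = 1 - s * r := by linarith
  have hr2 : r = 1 / (1 + s) := by field_simp; linarith
  have hUn : ‖U‖ ^ 2 ≤ ‖p‖ ^ 2 + ‖q‖ ^ 2 := by
    have := cvx p q (s * r) hsr (by linarith)
    rw [← hr', ← hU] at this
    nlinarith [sq_nonneg ‖p‖, sq_nonneg ‖q‖]
  have hYn : ‖Y‖ ^ 2 ≤ ‖p‖ ^ 2 + ‖q‖ ^ 2 := by
    have := cvx q p (s * r) hsr (by linarith)
    rw [← hr', ← hY] at this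
    nlinarith [sq_nonneg ‖p‖, sq_nonneg ‖q‖]
  have hU2 : U = (1 - s) • p + s • Y := by
    rw [hU, hY]
    rw [hr2]
    match_scalars <;> field_simp <;> ring
  have hUc : ‖U‖ ^ 2 ≤ (1 - s) * ‖p‖ ^ 2 + s * ‖Y‖ ^ 2 := by
    have := cvx p Y s hs.le hs1.le
    rwa [← hU2] at this
  have hg : s * inner ℝ g U = inner ℝ g Y - (1 - s) * inner ℝ g q := by
    have e : s • U = Y - (1 - s) • q := by
      rw [hU, hY]
      rw [hr2]
      match_scalars <;> field_simp <;> ring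
    have := congrArg (inner ℝ g) e
    rwa [inner_smul_right, inner_sub_right, inner_smul_right] at this
  have hn : ‖U - (s / μ) • (g + w)‖ ^ 2 = ‖U‖ ^ 2 - 2 * (s / μ) * (inner ℝ g U + inner ℝ U w)
      + (s / μ) ^ 2 * (‖g‖ ^ 2 + 2 * inner ℝ g w + ‖w‖ ^ 2) := by
    rw [norm_sub_sq_real, inner_smul_right, norm_smul, mul_pow, Real.norm_eq_abs, sq_abs,
      norm_add_sq_real, inner_add_right, real_inner_comm U g]; ring
  have hn2 : ‖-(α • (g + w))‖ ^ 2 = α ^ 2 * (‖g‖ ^ 2 + 2 * inner ℝ g w + ‖w‖ ^ 2) := by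
    rw [norm_neg, norm_smul, mul_pow, Real.norm_eq_abs, sq_abs, norm_add_sq_real]
  rw [hn2, inner_neg_right, inner_smul_right, inner_add_right, real_inner_self_eq_norm_sq] at h1
  rw [inner_sub_right] at h2
  rw [inner_neg_right, norm_neg] at h3
  have hm : μ / 2 * ‖U - (s / μ) • (g + w)‖ ^ 2 = μ / 2 * ‖U‖ ^ 2 - s * (inner ℝ g U + inner ℝ U w)
      + α / 2 * (‖g‖ ^ 2 + 2 * inner ℝ g w + ‖w‖ ^ 2) := by
    rw [hn]
    have : α = s ^ 2 / μ := by rw [hsq]; field_simp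
    rw [this]; field_simp
  rw [hm]
  -- first cross term
  have c1 : -(s * inner ℝ U w) ≤ s * μ / 8 * ‖U‖ ^ 2 + 2 * s / μ * ‖w‖ ^ 2 := by
    have i1 := (abs_le.1 (abs_real_inner_le_norm U w)).1
    have i2 : s * μ / 8 * ‖U‖ ^ 2 + 2 * s / μ * ‖w‖ ^ 2 - s * (‖U‖ * ‖w‖)
        = s / (8 * μ) * (μ * ‖U‖ - 4 * ‖w‖) ^ 2 := by field_simp; ring
    have i3 : 0 ≤ s / (8 * μ) * (μ * ‖U‖ - 4 * ‖w‖) ^ 2 := by positivity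
    nlinarith
  have c2 : α ^ 2 * L * inner ℝ g w ≤ s * μ / 16 * ‖Y‖ ^ 2
      + 4 * s * α ^ 3 * L ^ 4 / μ ^ 2 * ‖w‖ ^ 2 := by
    have i1 := real_inner_le_norm g w
    have i0 : ‖g‖ * ‖w‖ ≤ L * ‖Y‖ * ‖w‖ := mul_le_mul_of_nonneg_right h5 (norm_nonneg _)
    have i4 : α ^ 2 * L * inner ℝ g w ≤ α ^ 2 * L * (L * ‖Y‖ * ‖w‖) :=
      mul_le_mul_of_nonneg_left (i1.trans i0) (by positivity)
    have i2 : s * μ / 16 * ‖Y‖ ^ 2 + 4 * s * α ^ 3 * L ^ 4 / μ ^ 2 * ‖w‖ ^ 2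
        - α ^ 2 * L * (L * ‖Y‖ * ‖w‖)
        = 1 / (16 * s * μ) * (s * μ * ‖Y‖ - 8 * α ^ 2 * L ^ 2 * ‖w‖) ^ 2 := by
      have : μ = s ^ 2 / α := by rw [hsq]; field_simp
      rw [this]
      field_simp; ring
    have i3 : 0 ≤ 1 / (16 * s * μ) * (s * μ * ‖Y‖ - 8 * α ^ 2 * L ^ 2 * ‖w‖) ^ 2 := by positivity
    linarith
  have a2 := mul_le_mul_of_nonneg_left h2 (sub_nonneg.2 hs1.le)
  have a3 := mul_le_mul_of_nonneg_left h3 hs.le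
  have a0 : 0 ≤ (1 - s) * (μ / 2 * ‖q - Y‖ ^ 2) :=
    mul_nonneg (sub_nonneg.2 hs1.le) (by positivity)
  have aU := mul_le_mul_of_nonneg_left hUc (half_pos hμ).le
  have aUn := mul_le_mul_of_nonneg_left hUn (by positivity : 0 ≤ s * μ / 8)
  have aYn := mul_le_mul_of_nonneg_left hYn (by positivity : 0 ≤ s * μ / 16)
  have aF := mul_le_mul_of_nonneg_left h4 (half_pos hs).le
  have aG : 0 ≤ α / 2 * (1 - α * L) * ‖g‖ ^ 2 :=
    mul_nonneg (mul_nonneg (by positivity) (by linarith)) (sq_nonneg _)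
  have b1 : 0 ≤ s * μ * ‖p‖ ^ 2 := by positivity
  have b2 : 0 ≤ s * μ * ‖q‖ ^ 2 := by positivity
  linarith
end helpers

theorem aux_lim (μ L : ℝ) (hμ : 0 < μ) :
    Filter.Tendsto (fun t : ℝ => LNAG μ L t) (nhdsWithin 0 (Set.Ioi (0 : ℝ)))
      (nhds (2 * Real.sqrt 5 / Real.sqrt μ)) := by
  have hc : ContinuousAt (fun t : ℝ => LNAG μ L t) 0 := by
    unfold LNAG
    have h1 : Real.sqrt μ ≠ 0 := (Real.sqrt_pos.2 hμ).ne'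
    have h0 : μ ≠ 0 := hμ.ne'
    apply ContinuousAt.sqrt
    refine ContinuousAt.add (ContinuousAt.add ?_ ?_) ?_
    · refine ContinuousAt.div (by fun_prop) (by fun_prop) (by simpa using h0)
    · exact ContinuousAt.div (by fun_prop) (by fun_prop) h1
    · refine ContinuousAt.div (by fun_prop) (by fun_prop) (by simpa using h0)
  have e : LNAG μ L 0 = 2 * Real.sqrt 5 / Real.sqrt μ := by
    unfold LNAG
    rw [← Real.sqrt_sq (by positivity : 0 ≤ 2 * Real.sqrt 5 / Real.sqrt μ)]
    congr 1
    rw [div_pow, mul_pow, Real.sq_sqrt hμ.le, Real.sq_sqrt (by norm_num : (0:ℝ) ≤ 5)]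
    simp; norm_num
  rw [← e]
  exact hc.tendsto.mono_left nhdsWithin_le_nhds

/-- explicit ℓ2-gain bound for inexact NAG with stepsize `α ∈ (0, 1/L]` and
momentum `β = (1−√(αμ))/(1+√(αμ))`; moreover `L̄_NAG(α) → 2√5/√μ` as `α → 0⁺`. -/
theorem nag_l2_gain_bound (d : ℕ) (hd : 1 ≤ d) (μ L : ℝ) (hμ : 0 < μ) (hμL : μ < L)
    (f : EuclideanSpace ℝ (Fin d) → ℝ) (hdiff : Differentiable ℝ f)
    (hsc : ConvexOn ℝ Set.univ (fun x => f x - μ / 2 * ‖x‖ ^ 2))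
    (hsmooth : ∀ x y : EuclideanSpace ℝ (Fin d),
      ‖gradient f x - gradient f y‖ ≤ L * ‖x - y‖)
    (xstar : EuclideanSpace ℝ (Fin d)) (hmin : ∀ x, f xstar ≤ f x)
    (α : ℝ) (hα : 0 < α) (hαL : α ≤ 1 / L)
    (β : ℝ) (hβ : β = (1 - Real.sqrt (α * μ)) / (1 + Real.sqrt (α * μ)))
    (w x y : ℕ → EuclideanSpace ℝ (Fin d))
    (hy : ∀ k : ℕ, y k = x k + β • (x k - x (k - 1)))
    (hrec : ∀ k : ℕ,
      x (k + 1) = x k - α • (gradient f (y k) + w k) + β • (x k - x (k - 1)))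
    (hsum : Summable (fun k : ℕ => ‖w k‖ ^ 2)) :
    (Summable (fun k : ℕ => f (x k) - f xstar) ∧
      (∑' k : ℕ, (f (x k) - f xstar)) ≤
        LNAG μ L α ^ 2 * (∑' k : ℕ, ‖w k‖ ^ 2) +
          HbarNAG μ α f (f xstar) xstar (x 0)) ∧
    Filter.Tendsto (fun t : ℝ => LNAG μ L t) (nhdsWithin 0 (Set.Ioi (0 : ℝ)))
      (nhds (2 * Real.sqrt 5 / Real.sqrt μ)) := by
  refine ⟨?_, aux_lim μ L hμ⟩
  have hL : 0 < L := hμ.trans hμL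
  have hαL' : α * L ≤ 1 := by rwa [le_div_iff₀ hL] at hαL
  set s := Real.sqrt (α * μ) with hsdef
  have hs : 0 < s := Real.sqrt_pos.2 (by positivity)
  have hsq : s ^ 2 = α * μ := Real.sq_sqrt (by positivity)
  have hs1 : s < 1 := by
    have : α * μ < α * L := mul_lt_mul_of_pos_left hμL hα
    nlinarith
  obtain ⟨r, hrdef⟩ : ∃ r, r = 1 / (1 + s) := ⟨_, rfl⟩
  have hr0 : 0 < r := by rw [hrdef]; positivity
  have hr : r * (1 + s) = 1 := by rw [hrdef]; field_simp
  have hβ' : β = (1 - s) * r := by rw [hβ, hrdef]; ring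
  have hgs : gradient f xstar = 0 := by
    have : IsLocalMin f xstar := Filter.Eventually.of_forall hmin
    simp [gradient, this.fderiv_eq_zero]
  set C := 2 * s / μ + α * (1 + α * L) / 2 + 4 * s * α ^ 3 * L ^ 4 / μ ^ 2 with hC
  set z : ℕ → EuclideanSpace ℝ (Fin d) := fun k => x (k - 1) + (1 / s) • (x k - x (k - 1)) with hz
  set V : ℕ → ℝ := fun k => f (x k) - f xstar + μ / 2 * ‖z k - xstar‖ ^ 2 with hV
  have hVnn : ∀ k, 0 ≤ V k := fun k => by
    have := hmin (x k)
    have h2 : 0 ≤ μ / 2 * ‖z k - xstar‖ ^ 2 := by positivity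
    simp only [hV]; linarith
  have hstep : ∀ k, V (k + 1) + s / 2 * (f (x k) - f xstar) ≤ V k + C * ‖w k‖ ^ 2 := by
    intro k
    set g := gradient f (y k) with hg
    have ex : x (k + 1) = y k + -(α • (g + w k)) := by rw [hrec, ← hg, hy]; abel
    have eY : y k - xstar = r • (x k - xstar) + (s * r) • (z k - xstar) := by
      rw [hy, hβ', hrdef]
      simp only [hz]
      match_scalars <;> field_simp <;> ring
    have eU : z (k + 1) - xstar = (r • (z k - xstar) + (s * r) • (x k - xstar))
        - (s / μ) • (g + w k) := by
      have e1 : s / μ = (1 / s) * α := by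
        field_simp; linarith
      rw [e1]
      simp only [hz, Nat.add_sub_cancel]
      rw [ex, hy, hβ', hrdef]
      match_scalars <;> field_simp <;> ring
    have h1 := aux_descent f hdiff L hsmooth (y k) (-(α • (g + w k)))
    have h2 := aux_sc f hdiff μ hsc (y k) ((x k - xstar) - (y k - xstar))
    have h3 := aux_sc f hdiff μ hsc (y k) (-(y k - xstar))
    have h4 := aux_sc f hdiff μ hsc xstar (x k - xstar)
    have h5 := hsmooth (y k) xstar
    rw [← ex] at h1
    rw [show y k + ((x k - xstar) - (y k - xstar)) = x k by abel] at h2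
    rw [show y k + (-(y k - xstar)) = xstar by abel] at h3
    rw [hgs, inner_zero_left, add_sub_cancel] at h4
    rw [hgs, sub_zero] at h5
    have := aux_step (z k - xstar) (x k - xstar) g (w k) s r μ L α (f (x k) - f xstar)
      (f (x (k + 1)) - f xstar) (f (y k) - f xstar) hs hs1 hr hr0 hμ hL hα hαL' hsq
      (y k - xstar) _ eY rfl (by linarith) (by linarith) (by linarith) (by linarith) h5
    rw [← eU] at this
    simp only [hV, hC]
    linarith
  have hsumN : ∀ n, V n + s / 2 * ∑ k ∈ Finset.range n, (f (x k) - f xstar)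
      ≤ V 0 + C * ∑ k ∈ Finset.range n, ‖w k‖ ^ 2 := by
    intro n
    induction n with
    | zero => simp
    | succ n ih =>
      rw [Finset.sum_range_succ, Finset.sum_range_succ]
      linarith [hstep n]
  have hCnn : 0 ≤ C := by positivity
  set W := ∑' k : ℕ, ‖w k‖ ^ 2 with hW
  have hWnn : 0 ≤ W := tsum_nonneg (fun k => sq_nonneg _)
  have hbd : ∀ n, ∑ k ∈ Finset.range n, (f (x k) - f xstar) ≤ 2 / s * (V 0 + C * W) := by
    intro n
    have h1 := hsumN n
    have h2 : ∑ k ∈ Finset.range n, ‖w k‖ ^ 2 ≤ W :=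
      hsum.sum_le_tsum _ (fun k _ => sq_nonneg _)
    have h3 := mul_le_mul_of_nonneg_left h2 hCnn
    have h4 : s / 2 * ∑ k ∈ Finset.range n, (f (x k) - f xstar) ≤ V 0 + C * W := by
      linarith [hVnn n]
    have h5 := mul_le_mul_of_nonneg_left h4 (by positivity : 0 ≤ 2 / s)
    rw [← mul_assoc, show 2 / s * (s / 2) = 1 by field_simp, one_mul] at h5
    exact h5
  have hnn : ∀ k, 0 ≤ f (x k) - f xstar := fun k => sub_nonneg.2 (hmin _)
  refine ⟨summable_of_sum_range_le hnn hbd, (Real.tsum_le_of_sum_range_le hnn hbd).trans ?_⟩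
  have hV0 : V 0 = f (x 0) - f xstar + μ / 2 * ‖x 0 - xstar‖ ^ 2 := by
    simp [hV, hz]
  have hH : 2 / s * V 0 ≤ HbarNAG μ α f (f xstar) xstar (x 0) := by
    unfold HbarNAG
    rw [← hsdef, ← hV0, ← hsq]
    have t1 : 0 < 5 - 2 * s + s ^ 2 := by nlinarith
    have t2 : 0 ≤ 1 - s := by linarith
    have h1 : 0 ≤ s * (1 - s) / (4 * (5 - 2 * s + s ^ 2)) := by positivity
    have h2 : 0 ≤ s * (1 - s) ^ 2 / (4 * (4 + (1 - s) ^ 2)) := by positivity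
    have h3 : 2 / s * 1 ≤ 2 / s * (1 + s * (1 - s) / (4 * (5 - 2 * s + s ^ 2)) +
      s * (1 - s) ^ 2 / (4 * (4 + (1 - s) ^ 2))) :=
      mul_le_mul_of_nonneg_left (by linarith) (by positivity)
    have := mul_le_mul_of_nonneg_right h3 (hVnn 0)
    rwa [mul_one] at this
  have hLC : 2 / s * C ≤ LNAG μ L α ^ 2 := by
    unfold LNAG
    rw [← hsdef]
    have t1 : 0 < 5 - 2 * s + α * μ := by rw [← hsq]; nlinarith
    rw [Real.sq_sqrt (by positivity)]
    have e : 2 / s * C = 4 / μ + α * (1 + α * L) / s + 8 * α ^ 3 * L ^ 4 / μ ^ 2 := by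
      rw [hC]; field_simp; ring
    have e2 : α * (1 + α * L) / s = Real.sqrt α * (1 + α * L) / Real.sqrt μ := by
      have : s = Real.sqrt α * Real.sqrt μ := Real.sqrt_mul hα.le μ
      have h1 : 0 < Real.sqrt α := Real.sqrt_pos.2 hα
      have h2 : 0 < Real.sqrt μ := Real.sqrt_pos.2 hμ
      have h3 : Real.sqrt α ^ 2 = α := Real.sq_sqrt hα.le
      rw [this, div_eq_div_iff (by positivity) (by positivity)]
      linear_combination (-(1 + α * L) * Real.sqrt μ) * h3
    rw [e, e2]
    have k1 : 4 / μ ≤ 4 * (5 - 2 * s + α * μ) / (μ * (1 + s) ^ 2) := by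
      rw [div_le_div_iff₀ hμ (by positivity), ← hsq]
      nlinarith [mul_nonneg hμ.le (sub_nonneg.2 hs1.le)]
    have k2 : 8 * α ^ 3 * L ^ 4 / μ ^ 2 ≤ 8 * α ^ 3 * L ^ 4 * (4 + (1 - s) ^ 2) / (μ ^ 2 * (1 + s) ^ 2) := by
      have : 1 ≤ (4 + (1 - s) ^ 2) / (1 + s) ^ 2 := by
        rw [le_div_iff₀ (by positivity)]; nlinarith
      have := mul_le_mul_of_nonneg_left this (by positivity : 0 ≤ 8 * α ^ 3 * L ^ 4 / μ ^ 2)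
      rwa [mul_one, div_mul_div_comm] at this
    linarith
  have := mul_le_mul_of_nonneg_right hLC hWnn
  linarith
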